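/- arXiv:1503.03637 — 3 statements merged into one kernel-verified Lean document; each statement's English description precedes it below -/
import Mathlib

section
/- Let t̂₁, t̂₂, t̂₃ be vectors in ℝ³, R a 3×3 rotation matrix, and α₁, α₂, α₃ real numbers such that α₁ t̂₁ = α₂ (R t̂₂) + α₃ t̂₃. Then α₃ · ‖(R t̂₂) × t̂₃‖² = α₁ · ⟨(R t̂₂) × t̂₁, (R t̂₂) × t̂₃⟩, where × denotes the cross product on ℝ³ and ⟨·,·⟩ the Euclidean inner product. In particular, if (R t̂₂) × t̂₃ ≠ 0, then α₃/α₁ = ⟨(R t̂₂) × t̂₁, (R t̂₂) × t̂₃⟩ / ‖(R t̂₂) × t̂₃‖² whenever α₁ ≠ 0. -/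
open Matrix

/-- The Zeller–Faugeras relation: if `α₁ t̂₁ = α₂ (R t̂₂) + α₃ t̂₃` with `R ∈ SO(3)`, then
`α₃ ‖(R t̂₂) × t̂₃‖² = α₁ ⟨(R t̂₂) × t̂₁, (R t̂₂) × t̂₃⟩`; in particular, when
`(R t̂₂) × t̂₃ ≠ 0` and `α₁ ≠ 0`, the ratio `α₃/α₁` is given by the quotient of these
inner products.  Here the inner product is the Euclidean dot product on `ℝ³`, so
`‖v‖² = v ⬝ᵥ v`. -/
theorem zeller_faugeras (t1 t2 t3 : Fin 3 → ℝ) (R : Matrix (Fin 3) (Fin 3) ℝ)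
    (hR : Rᵀ * R = 1 ∧ R.det = 1) (α₁ α₂ α₃ : ℝ)
    (h : α₁ • t1 = α₂ • (R *ᵥ t2) + α₃ • t3) :
    α₃ * (crossProduct (R *ᵥ t2) t3 ⬝ᵥ crossProduct (R *ᵥ t2) t3) =
      α₁ * (crossProduct (R *ᵥ t2) t1 ⬝ᵥ crossProduct (R *ᵥ t2) t3) ∧
    (crossProduct (R *ᵥ t2) t3 ≠ 0 → α₁ ≠ 0 →
      α₃ / α₁ = (crossProduct (R *ᵥ t2) t1 ⬝ᵥ crossProduct (R *ᵥ t2) t3) /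
        (crossProduct (R *ᵥ t2) t3 ⬝ᵥ crossProduct (R *ᵥ t2) t3)) := by
  have hcross : α₁ • crossProduct (R *ᵥ t2) t1 = α₃ • crossProduct (R *ᵥ t2) t3 := by
    rw [← map_smul, h, map_add, map_smul, map_smul, cross_self, smul_zero, zero_add]
  have hscale : α₃ * (crossProduct (R *ᵥ t2) t3 ⬝ᵥ crossProduct (R *ᵥ t2) t3) =
      α₁ * (crossProduct (R *ᵥ t2) t1 ⬝ᵥ crossProduct (R *ᵥ t2) t3) := by
    rw [← smul_eq_mul, ← smul_eq_mul, ← smul_dotProduct, ← smul_dotProduct, hcross]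
  refine ⟨hscale, fun hne hα₁ => ?_⟩
  rw [div_eq_div_iff hα₁ (mt dotProduct_self_eq_zero.mp hne), hscale, mul_comm]
end

section
/- Let c_1, c_2, c_3 be pairwise distinct collinear points in ℝ³, and let A be the 3×3 real matrix whose columns are c_2 − c_1, c_3 − c_2, c_1 − c_3. Then the null space of A has dimension at least 2; in particular the homogeneous system A α = 0 has solutions that are not proportional to one another, so the scale factors are not determined up to a single global scale. -/
open Matrix

/-- Two vectors in the kernel of a linear map, the first nonzero and the second not a multiple
of it, force the kernel to have dimension at least 2. -/
theorem two_le_finrank_ker_of_not_proportional {K V W : Type*} [Field K] [AddCommGroup V]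
    [Module K V] [FiniteDimensional K V] [AddCommGroup W] [Module K W] (f : V →ₗ[K] W) {x y : V}
    (hx : f x = 0) (hy : f y = 0) (hx0 : x ≠ 0) (hxy : ∀ s : K, y ≠ s • x) :
    2 ≤ Module.finrank K (LinearMap.ker f) := by
  have hli : LinearIndependent K ![(⟨x, hx⟩ : LinearMap.ker f), ⟨y, hy⟩] := by
    refine (LinearIndependent.pair_iff' fun h => hx0 (congrArg Subtype.val h)).2 fun s h => ?_
    exact hxy s (congrArg Subtype.val h).symm
  simpa using hli.fintype_card_le_finrank

/-- For three pairwise distinct collinear points `c 0, c 1, c 2` in `ℝ³`, the 3×3 matrix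
whose columns are the cyclic differences `c 1 - c 0, c 2 - c 1, c 0 - c 2` has null space
of dimension at least 2; in particular the homogeneous system has two solutions neither
of which is a scalar multiple of the other, so the scale factors are not determined up
to a single global scale. -/
theorem collinear_triangle_kernel (c : Fin 3 → (Fin 3 → ℝ))
    (hdist : Function.Injective c) (hcol : Collinear ℝ (Set.range c)) :
    2 ≤ Module.finrank ℝ (LinearMap.ker (Matrix.of fun (i : Fin 3) (k : Fin 3) =>
        (c (k + 1) - c k) i).mulVecLin) ∧
    ∃ x y : Fin 3 → ℝ,
      (Matrix.of fun (i : Fin 3) (k : Fin 3) => (c (k + 1) - c k) i) *ᵥ x = 0 ∧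
      (Matrix.of fun (i : Fin 3) (k : Fin 3) => (c (k + 1) - c k) i) *ᵥ y = 0 ∧
      (∀ s : ℝ, x ≠ s • y) ∧ (∀ s : ℝ, y ≠ s • x) := by
  obtain ⟨p, v, hpv⟩ := (collinear_iff_exists_forall_eq_smul_vadd (Set.range c)).1 hcol
  choose r hr using fun k => hpv (c k) ⟨k, rfl⟩
  have hr01 : r 1 ≠ r 0 := fun h => by
    have : c 1 = c 0 := by rw [hr 1, hr 0, h]
    exact absurd (hdist this) (by decide)
  have hcr : ∀ k i, c k i = r k * v i + p i := fun k i => by simp [congrFun (hr k) i]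
  set A : Matrix (Fin 3) (Fin 3) ℝ :=
    Matrix.of fun (i : Fin 3) (k : Fin 3) => (c (k + 1) - c k) i with hA
  let x : Fin 3 → ℝ := ![1, 1, 1]
  let y : Fin 3 → ℝ := ![r 2 - r 1, r 0 - r 1, 0]
  have hx : A *ᵥ x = 0 := by
    ext i
    simp [hA, x, Matrix.mulVec, dotProduct, Fin.sum_univ_three]
  have hy : A *ᵥ y = 0 := by
    ext i
    simp [hA, y, Matrix.mulVec, dotProduct, Fin.sum_univ_three, hcr]
    ring
  have hxy : ∀ s : ℝ, x ≠ s • y := fun s h => by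
    simpa [x, y] using congrFun h 2
  have hyx : ∀ s : ℝ, y ≠ s • x := fun s h => by
    have h2 : 0 = s := by simpa [x, y] using congrFun h 2
    have h1 : r 0 - r 1 = s := by simpa [x, y] using congrFun h 1
    exact hr01 (by linarith)
  have hx0 : x ≠ 0 := by simpa using hxy 0
  exact ⟨two_le_finrank_ker_of_not_proportional A.mulVecLin hx hy hx0 hyx, x, y, hx, hy, hxy, hyx⟩
end

section
/- Let c_1, c_2, c_3, c_4 be affinely independent points in ℝ³ (i.e., in general position, not lying on a common plane), and let A be the 3×4 real matrix whose columns are c_2 − c_1, c_3 − c_2, c_4 − c_3, c_1 − c_4. Then the null space of A is exactly the one-dimensional subspace of ℝ⁴ spanned by (1, 1, 1, 1). In particular, the homogeneous system A α = 0 determines α ∈ ℝ⁴ uniquely up to a global scalar. -/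
open Matrix

/-- For four affinely independent points `c 0, c 1, c 2, c 3` in `ℝ³` (cameras in general
position), the 3×4 matrix whose columns are the cyclic differences
`c 1 - c 0, c 2 - c 1, c 3 - c 2, c 0 - c 3` has null space exactly the line spanned by
`(1,1,1,1)`: the homogeneous system determines the scales uniquely up to a global
scalar. -/
theorem quadrilateral_kernel (c : Fin 4 → (Fin 3 → ℝ)) (hc : AffineIndependent ℝ c) :
    LinearMap.ker (Matrix.of fun (i : Fin 3) (k : Fin 4) =>
        (c (k + 1) - c k) i).mulVecLin
      = Submodule.span ℝ {(fun _ => 1 : Fin 4 → ℝ)} := by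
  ext α
  rw [LinearMap.mem_ker, Submodule.mem_span_singleton]
  constructor
  · intro h
    have neg_one_eq : (-1 : Fin 4) = 3 := rfl
    have hw := affineIndependent_iff.mp hc Finset.univ (fun k => α (k - 1) - α k)
      (by simp [Fin.sum_univ_four, neg_one_eq]; ring)
      (by
        ext i
        have hi := congrFun h i
        simp [Matrix.mulVec, dotProduct, Fin.sum_univ_four, neg_one_eq] at hi ⊢
        linear_combination hi)
    have h₁ : α 0 - α 1 = 0 := hw 1 (Finset.mem_univ _)
    have h₂ : α 1 - α 2 = 0 := hw 2 (Finset.mem_univ _)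
    have h₃ : α 2 - α 3 = 0 := hw 3 (Finset.mem_univ _)
    refine ⟨α 0, ?_⟩
    ext k
    fin_cases k <;> simp <;> linarith
  · rintro ⟨a, rfl⟩
    ext i
    simp [Matrix.mulVec, dotProduct, Fin.sum_univ_four]
    right
    ring
end
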